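/- Let ω be an infinite word, let Λ = {λ_u}_{u∈F_ω} be bounded weights with λ_u > 0, let S = (S_1,…,S_n) be the unweighted shift on K_ω, and let P_H be an orthogonal projection on K_ω with P_H ≠ 0 and P_H ≠ I which commutes with every S_i. Let Π̄ be a partition of F_ω into non-empty subsets such that: (a) Q_J commutes with P_H for every J ∈ Π̄; (b) Π̄ refines the partition of F_ω into level sets {u : λ_u = r} of the weights; and (c) Π̄ is maximal with properties (a) and (b) under refinement. Then every J ∈ Π̄ contains at least two elements, and there exist J_1 ∈ Π̄ and a non-empty word w ∈ F_n^+ such that wJ_1 = J_1; in particular, J_1 contains an element of the main branch { ω_m^{-1} : m ≥ 0 } of F_ω. -/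

import Mathlib

open scoped ENNReal InnerProductSpace

noncomputable section

variable {n : ℕ}

/-- The element of the free group determined by a word (list of generators). -/
def wordProd (l : List (Fin n)) : FreeGroup (Fin n) := (l.map FreeGroup.of).prod

/-- The initial segment `ω_m = i_1 i_2 ⋯ i_m` of an infinite word `ω`. -/
def initSeg (ω : ℕ → Fin n) (m : ℕ) : List (Fin n) := List.ofFn fun j : Fin m => ω j

/-- The set `F_ω = { v ω_m⁻¹ : v ∈ F_n^+, m ≥ 0 }` inside the free group. -/
def Fomega (ω : ℕ → Fin n) : Set (FreeGroup (Fin n)) :=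
  {g | ∃ (v : List (Fin n)) (m : ℕ), g = wordProd v * (wordProd (initSeg ω m))⁻¹}

lemma genMul_mem (ω : ℕ → Fin n) (i : Fin n) {g : FreeGroup (Fin n)} (hg : g ∈ Fomega ω) :
    FreeGroup.of i * g ∈ Fomega ω := by
  obtain ⟨v, m, rfl⟩ := hg
  exact ⟨i :: v, m, by simp [wordProd, mul_assoc]⟩

/-- `K_ω = ℓ²(F_ω)`. -/
abbrev Komega (ω : ℕ → Fin n) : Type _ := lp (fun _ : Fomega ω => ℂ) 2

/-- The standard orthonormal basis vector `ξ_u` of `K_ω`. -/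
def xi (ω : ℕ → Fin n) (u : Fomega ω) : Komega ω := lp.single 2 u 1

/-- `iu` as an element of `F_ω`. -/
def gen (ω : ℕ → Fin n) (i : Fin n) (u : Fomega ω) : Fomega ω :=
  ⟨FreeGroup.of i * u.1, genMul_mem ω i u.2⟩

/-- `T = (T_1,…,T_n)` is the bilateral weighted shift on `K_ω` with (complex) weights `Λ`:
`T_i ξ_u = λ_{iu} ξ_{iu}`. -/
def IsWeightedShift (ω : ℕ → Fin n) (Λ : Fomega ω → ℂ)
    (T : Fin n → Komega ω →L[ℂ] Komega ω) : Prop :=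
  ∀ (i : Fin n) (u : Fomega ω), T i (xi ω u) = Λ (gen ω i u) • xi ω (gen ω i u)

/-- real-weight version -/
def IsWeightedShiftR (ω : ℕ → Fin n) (Λ : Fomega ω → ℝ)
    (T : Fin n → Komega ω →L[ℂ] Komega ω) : Prop :=
  ∀ (i : Fin n) (u : Fomega ω), T i (xi ω u) = (Λ (gen ω i u) : ℂ) • xi ω (gen ω i u)

/-- A closed subspace `H` is reducing for an operator `A` if `H` and `Hᗮ` are `A`-invariant. -/
def Reduces {E : Type*} [NormedAddCommGroup E] [InnerProductSpace ℂ E]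
    (A : E →L[ℂ] E) (H : Submodule ℂ E) : Prop :=
  (∀ x ∈ H, A x ∈ H) ∧ ∀ x ∈ Hᗮ, A x ∈ Hᗮ

/-- `w^k` for a finite word `w`. -/
def listPow (w : List (Fin n)) : ℕ → List (Fin n)
  | 0 => []
  | k + 1 => w ++ listPow w k

/-- A word is primitive if it is non-empty and not a proper power. -/
def Primitive (v : List (Fin n)) : Prop :=
  v ≠ [] ∧ ∀ (w : List (Fin n)) (j : ℕ), 2 ≤ j → v ≠ listPow w j

/-- `ω = v v v ⋯`. -/
def IsPeriodicWord (ω : ℕ → Fin n) (v : List (Fin n)) : Prop :=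
  v ≠ [] ∧ ∀ k : ℕ, initSeg ω (k * v.length) = listPow v k

/-- `ω = u v₀ v₀ v₀ ⋯` for some words `u, v₀` with `v₀` non-empty. -/
def EventuallyPeriodic (ω : ℕ → Fin n) : Prop :=
  ∃ N p : ℕ, 1 ≤ p ∧ ∀ m ≥ N, ω (m + p) = ω m

def Aperiodic (ω : ℕ → Fin n) : Prop := ¬EventuallyPeriodic ω

open Classical

/-- `Q` is the orthogonal projection of `K_ω` onto the closed span of `{ξ_u : u ∈ A}`
(a diagonal projection). This determines `Q` uniquely. -/
def IsDiagProj (ω : ℕ → Fin n) (A : Set (FreeGroup (Fin n)))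
    (Q : Komega ω →L[ℂ] Komega ω) : Prop :=
  ∀ u : Fomega ω, Q (xi ω u) = if u.1 ∈ A then xi ω u else 0

/-- `wJ = { w g : g ∈ J }`. -/
def mulSet (w : List (Fin n)) (A : Set (FreeGroup (Fin n))) : Set (FreeGroup (Fin n)) :=
  (fun g => wordProd w * g) '' A

/-- `w⁻¹J ∩ F_ω = { h ∈ F_ω : w h ∈ J }`. -/
def preSet (ω : ℕ → Fin n) (w : List (Fin n)) (A : Set (FreeGroup (Fin n))) :
    Set (FreeGroup (Fin n)) :=
  {h | h ∈ Fomega ω ∧ wordProd w * h ∈ A}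

/-- A partition of the set `F_ω` into non-empty subsets. -/
def IsPartitionOfFomega (ω : ℕ → Fin n) (𝔓 : Set (Set (FreeGroup (Fin n)))) : Prop :=
  (∀ J ∈ 𝔓, J.Nonempty ∧ J ⊆ Fomega ω) ∧
  ∀ g ∈ Fomega ω, ∃! J, J ∈ 𝔓 ∧ g ∈ J

/-- `𝔓₁` refines `𝔓₂`: every member of `𝔓₂` is a union of members of `𝔓₁`. -/
def RefinesPartition (𝔓₁ 𝔓₂ : Set (Set (FreeGroup (Fin n)))) : Prop :=
  ∀ J ∈ 𝔓₂, ∃ 𝒮 ⊆ 𝔓₁, J = ⋃₀ 𝒮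

/-- A partition of `F_ω` such that (a) every `Q_J`, `J ∈ 𝔓`, commutes with `P`, and
(b) `𝔓` refines the partition of `F_ω` into level sets of the weights `Λ`. -/
def GoodPartition (ω : ℕ → Fin n) (Λ : Fomega ω → ℝ)
    (P : Komega ω →L[ℂ] Komega ω) (𝔓 : Set (Set (FreeGroup (Fin n)))) : Prop :=
  IsPartitionOfFomega ω 𝔓 ∧
  (∀ J ∈ 𝔓, ∀ Q : Komega ω →L[ℂ] Komega ω, IsDiagProj ω J Q → Commute P Q) ∧
  (∀ J ∈ 𝔓, ∀ u v : Fomega ω, u.1 ∈ J → v.1 ∈ J → Λ u = Λ v)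

section FreeGroupTree

lemma wordProd_cons (i : Fin n) (a : List (Fin n)) :
    wordProd (i :: a) = FreeGroup.of i * wordProd a := by
  simp [wordProd]

lemma wordProd_injective : Function.Injective (wordProd (n := n)) := by
  have hmk : ∀ l : List (Fin n), wordProd l = FreeGroup.mk (l.map fun i => (i, true)) := by
    intro l
    induction l with
    | nil => rfl
    | cons i l ih => rw [wordProd_cons, ih]; rfl
  have hword : ∀ l : List (Fin n), (wordProd l).toWord = l.map fun i => (i, true) := by
    intro l
    rw [hmk, FreeGroup.toWord_mk]
    refine FreeGroup.IsReduced.reduce_eq ?_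
    rw [FreeGroup.IsReduced, List.isChain_map]
    induction l with
    | nil => simp
    | cons i l ih => cases l <;> simp_all
  intro a b hab
  have h : a.map (fun i => (i, true)) = b.map fun i => (i, true) := by
    rw [← hword, ← hword, hab]
  exact List.map_injective_iff.2 (fun i j hij => congrArg Prod.fst hij) h

/-- The action of a word on `F_ω` by left multiplication. -/
def wordAct (ω : ℕ → Fin n) (w : List (Fin n)) (u : Fomega ω) : Fomega ω :=
  w.foldr (gen ω) u

lemma wordAct_cons (ω : ℕ → Fin n) (i : Fin n) (w : List (Fin n)) (u : Fomega ω) :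
    wordAct ω (i :: w) u = gen ω i (wordAct ω w u) := rfl

lemma coe_wordAct (ω : ℕ → Fin n) (w : List (Fin n)) (u : Fomega ω) :
    (wordAct ω w u : FreeGroup (Fin n)) = wordProd w * u := by
  induction w with
  | nil => simp [wordAct, wordProd]
  | cons i w ih => rw [wordAct_cons, wordProd_cons, mul_assoc, ← ih]; rfl

/-- The element `ω_m⁻¹` of the main branch of `F_ω`. -/
def branch (ω : ℕ → Fin n) (m : ℕ) : Fomega ω :=
  ⟨(wordProd (initSeg ω m))⁻¹, [], m, by simp [wordProd]⟩

lemma branch_eq_gen (ω : ℕ → Fin n) (m : ℕ) :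
    branch ω m = gen ω (ω m) (branch ω (m + 1)) := by
  have h : initSeg ω (m + 1) = initSeg ω m ++ [ω m] := by
    rw [initSeg, List.ofFn_succ_last]
    rfl
  apply Subtype.ext
  simp [branch, gen, h, wordProd]

lemma exists_wordAct_branch (ω : ℕ → Fin n) (u : Fomega ω) :
    ∃ m, ∀ M ≥ m, ∃ a, u = wordAct ω a (branch ω M) := by
  obtain ⟨g, v, m, rfl⟩ := u
  refine ⟨m, fun M hM => ?_⟩
  induction M, hM using Nat.le_induction with
  | base => exact ⟨v, Subtype.ext (coe_wordAct ω v (branch ω m)).symm⟩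
  | succ M _ ih =>
    obtain ⟨a, ha⟩ := ih
    refine ⟨a ++ [ω M], ?_⟩
    rw [ha, branch_eq_gen]
    simp [wordAct]

lemma exists_common_branch (ω : ℕ → Fin n) (u v : Fomega ω) :
    ∃ m a b, u = wordAct ω a (branch ω m) ∧ v = wordAct ω b (branch ω m) := by
  obtain ⟨k, hk⟩ := exists_wordAct_branch ω u
  obtain ⟨l, hl⟩ := exists_wordAct_branch ω v
  obtain ⟨a, ha⟩ := hk (max k l) (le_max_left _ _)
  obtain ⟨b, hb⟩ := hl (max k l) (le_max_right _ _)
  exact ⟨_, a, b, ha, hb⟩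

lemma gen_eq_gen_iff (ω : ℕ → Fin n) {i j : Fin n} {u v : Fomega ω} :
    gen ω i u = gen ω j v ↔ i = j ∧ u = v := by
  refine ⟨fun h => ?_, fun ⟨hij, huv⟩ => by rw [hij, huv]⟩
  obtain ⟨m, a, b, rfl, rfl⟩ := exists_common_branch ω u v
  rw [← wordAct_cons, ← wordAct_cons, Subtype.ext_iff, coe_wordAct, coe_wordAct] at h
  obtain ⟨rfl, rfl⟩ := List.cons.inj (wordProd_injective (mul_right_cancel h))
  exact ⟨rfl, rfl⟩

lemma exists_eq_gen (ω : ℕ → Fin n) (u : Fomega ω) : ∃ i v, u = gen ω i v := by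
  obtain ⟨m, hm⟩ := exists_wordAct_branch ω u
  obtain ⟨a, rfl⟩ := hm m le_rfl
  cases a with
  | nil => exact ⟨_, _, branch_eq_gen ω m⟩
  | cons i a => exact ⟨i, _, wordAct_cons ω i a _⟩

end FreeGroupTree

section MatrixEntries

variable {ω : ℕ → Fin n}

lemma xi_apply (u v : Fomega ω) : xi ω u v = if v = u then 1 else 0 := by
  rw [xi, lp.single_apply, Pi.single_apply]

lemma ext_of_xi {F : Type*} [AddCommMonoid F] [Module ℂ F] [TopologicalSpace F] [T2Space F]
    {A B : Komega ω →L[ℂ] F} (h : ∀ u, A (xi ω u) = B (xi ω u)) : A = B := by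
  refine lp.ext_continuousLinearMap (ENNReal.ofNat_ne_top (n := nat_lit 2)) fun u => ?_
  ext
  exact h u

lemma shift_apply_gen {S : Fin n → Komega ω →L[ℂ] Komega ω}
    (hS : IsWeightedShiftR ω (fun _ => 1) S) (i j : Fin n) (x : Komega ω) (u : Fomega ω) :
    S i x (gen ω j u) = if i = j then x u else 0 := by
  let A : Komega ω →L[ℂ] ℂ := (lp.evalCLM ℂ (fun _ => ℂ) 2 (gen ω j u)).comp (S i)
  let B : Komega ω →L[ℂ] ℂ := if i = j then lp.evalCLM ℂ (fun _ => ℂ) 2 u else 0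
  have hAB : A = B := ext_of_xi fun v => by
    have hA : A (xi ω v) = xi ω (gen ω i v) (gen ω j u) := by
      change S i (xi ω v) (gen ω j u) = _
      rw [hS]
      simp
    rw [hA, xi_apply]
    simp only [gen_eq_gen_iff]
    by_cases hij : i = j
    · subst hij
      have hB : B (xi ω v) = xi ω v u := by simp only [B, if_true]; rfl
      simp [hB, xi_apply]
    · simp [B, hij, Ne.symm hij]
  have hx : S i x (gen ω j u) = B x := congrArg (fun T => T x) hAB
  rw [hx]
  by_cases hij : i = j <;> simp only [B, hij, if_true, if_false] <;> rfl

lemma diagProj_apply {A : Set (FreeGroup (Fin n))} {Q : Komega ω →L[ℂ] Komega ω}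
    (hQ : IsDiagProj ω A Q) (x : Komega ω) (u : Fomega ω) :
    Q x u = if u.1 ∈ A then x u else 0 := by
  let R : Komega ω →L[ℂ] ℂ := (lp.evalCLM ℂ (fun _ => ℂ) 2 u).comp Q
  let B : Komega ω →L[ℂ] ℂ := if u.1 ∈ A then lp.evalCLM ℂ (fun _ => ℂ) 2 u else 0
  have hRB : R = B := ext_of_xi fun v => by
    change Q (xi ω v) u = _
    have hB : B (xi ω v) = if u.1 ∈ A then xi ω v u else 0 := by
      by_cases hu : u.1 ∈ A <;> simp only [B, hu, if_true, if_false] <;> rfl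
    rw [hQ, hB]
    by_cases huv : u = v
    · subst huv
      split_ifs <;> rfl
    · split_ifs <;> simp [xi_apply, huv]
  have hx : Q x u = B x := congrArg (fun T => T x) hRB
  rw [hx]
  by_cases hu : u.1 ∈ A <;> simp only [B, hu, if_true, if_false] <;> rfl

lemma exists_isDiagProj (A : Set (FreeGroup (Fin n))) :
    ∃ Q : Komega ω →L[ℂ] Komega ω, IsDiagProj ω A Q := by
  let K : Submodule ℂ (Komega ω) :=
    (Submodule.span ℂ {x | ∃ u : Fomega ω, u.1 ∈ A ∧ x = xi ω u}).topologicalClosure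
  have : CompleteSpace K := (Submodule.isClosed_topologicalClosure _).completeSpace_coe
  refine ⟨K.starProjection, fun u => ?_⟩
  split_ifs with hu
  · exact Submodule.starProjection_eq_self_iff.2
      (Submodule.le_topologicalClosure _ (Submodule.subset_span ⟨u, hu, rfl⟩))
  · rw [Submodule.starProjection_apply_eq_zero_iff, Submodule.orthogonal_closure]
    rw [Submodule.mem_orthogonal]
    intro x hx
    induction hx using Submodule.span_induction with
    | mem x hx =>
      obtain ⟨v, hv, rfl⟩ := hx
      have huv : u ≠ v := fun h => hu (h ▸ hv)
      rw [xi, lp.inner_single_left, xi_apply, if_neg huv.symm, inner_zero_right]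
    | zero => exact inner_zero_left _
    | add x y _ _ hx hy => rw [inner_add_left, hx, hy, add_zero]
    | smul c x _ hx => rw [inner_smul_left, hx, mul_zero]

/-- A diagonal projection commutes with `P` iff no non-zero matrix entry of `P` links its index
set to the complement. -/
lemma commute_diagProj_iff {P Q : Komega ω →L[ℂ] Komega ω} {A : Set (FreeGroup (Fin n))}
    (hQ : IsDiagProj ω A Q) :
    Commute P Q ↔ ∀ u v : Fomega ω, P (xi ω v) u ≠ 0 → (u.1 ∈ A ↔ v.1 ∈ A) := by
  have hPQ : ∀ u v : Fomega ω, (P * Q) (xi ω v) u = if v.1 ∈ A then P (xi ω v) u else 0 := by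
    intro u v
    change P (Q (xi ω v)) u = _
    rw [hQ]
    split_ifs <;> simp
  have hQP : ∀ u v : Fomega ω, (Q * P) (xi ω v) u = if u.1 ∈ A then P (xi ω v) u else 0 :=
    fun u v => diagProj_apply hQ _ u
  constructor
  · intro h u v huv
    have := hPQ u v
    rw [h.eq, hQP] at this
    split_ifs at this <;> simp_all
  · intro h
    refine ext_of_xi fun v => lp.ext (funext fun u => ?_)
    rw [hPQ, hQP]
    by_cases huv : P (xi ω v) u = 0
    · simp [huv]
    · simp [h u v huv]

lemma entry_gen_gen {S : Fin n → Komega ω →L[ℂ] Komega ω}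
    (hS : IsWeightedShiftR ω (fun _ => 1) S) {P : Komega ω →L[ℂ] Komega ω}
    (hPS : ∀ i : Fin n, Commute P (S i)) (i j : Fin n) (u v : Fomega ω) :
    P (xi ω (gen ω i v)) (gen ω j u) = if i = j then P (xi ω v) u else 0 := by
  have h : P (xi ω (gen ω i v)) = S i (P (xi ω v)) := by
    have h1 : S i (xi ω v) = xi ω (gen ω i v) := by simpa using hS i v
    rw [← h1]
    exact congrArg (fun T => T (xi ω v)) (hPS i).eq
  rw [h, shift_apply_gen hS]

lemma apply_eq_zero_of_inner_eq_zero {E : Type*} [NormedAddCommGroup E] [InnerProductSpace ℂ E]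
    [CompleteSpace E] {P : E →L[ℂ] E} (hPsa : IsSelfAdjoint P) (hPidem : P * P = P) {x : E}
    (hx : ⟪x, P x⟫_ℂ = 0) : P x = 0 := by
  rw [← inner_self_eq_zero (𝕜 := ℂ), ← ContinuousLinearMap.adjoint_inner_right]
  rw [ContinuousLinearMap.isSelfAdjoint_iff'.1 hPsa]
  rwa [← hPidem] at hx

lemma eq_zero_of_diag_eq_zero {P : Komega ω →L[ℂ] Komega ω} (hPsa : IsSelfAdjoint P)
    (hPidem : P * P = P) (h : ∀ u, P (xi ω u) u = 0) : P = 0 := by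
  refine ext_of_xi fun u => ?_
  refine apply_eq_zero_of_inner_eq_zero hPsa hPidem ?_
  rw [xi, lp.inner_single_left]
  change ⟪(1 : ℂ), P (xi ω u) u⟫_ℂ = 0
  rw [h, inner_zero_right]

/-- Diagonal entries of an operator commuting with the shifts are all equal. -/
lemma diag_entry_eq {S : Fin n → Komega ω →L[ℂ] Komega ω}
    (hS : IsWeightedShiftR ω (fun _ => 1) S) {P : Komega ω →L[ℂ] Komega ω}
    (hPS : ∀ i : Fin n, Commute P (S i)) (u v : Fomega ω) :
    P (xi ω u) u = P (xi ω v) v := by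
  have h : ∀ (a : List (Fin n)) (z : Fomega ω),
      P (xi ω (wordAct ω a z)) (wordAct ω a z) = P (xi ω z) z := by
    intro a z
    induction a with
    | nil => rfl
    | cons i a ih => rw [wordAct_cons, entry_gen_gen hS hPS, if_pos rfl, ih]
  obtain ⟨m, a, b, rfl, rfl⟩ := exists_common_branch ω u v
  rw [h, h]

/-- Every column of a non-trivial projection commuting with the shifts has a non-zero
off-diagonal entry. -/
lemma exists_offDiag_entry_ne_zero {S : Fin n → Komega ω →L[ℂ] Komega ω}
    (hS : IsWeightedShiftR ω (fun _ => 1) S) {P : Komega ω →L[ℂ] Komega ω}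
    (hPsa : IsSelfAdjoint P) (hPidem : P * P = P) (hP0 : P ≠ 0) (hP1 : P ≠ 1)
    (hPS : ∀ i : Fin n, Commute P (S i)) (u : Fomega ω) :
    ∃ v, v ≠ u ∧ P (xi ω u) v ≠ 0 := by
  by_contra! hcon
  have hPu : P (xi ω u) = P (xi ω u) u • xi ω u := by
    refine lp.ext (funext fun v => ?_)
    by_cases hv : v = u
    · subst hv
      simp [xi_apply]
    · simp [hcon v hv, xi_apply, hv]
  have hsq : P (xi ω u) u * P (xi ω u) u = P (xi ω u) u := by
    have h : P (P (xi ω u)) u = P (xi ω u) u := congrArg (fun T => T (xi ω u) u) hPidem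
    rw [hPu, map_smul] at h
    simpa [xi_apply] using h
  rcases IsIdempotentElem.iff_eq_zero_or_one.1 hsq with h0 | h1
  · exact hP0 (eq_zero_of_diag_eq_zero hPsa hPidem fun v => by rw [diag_entry_eq hS hPS v u, h0])
  · refine hP1 (sub_eq_zero.1 (eq_zero_of_diag_eq_zero (P := 1 - P) ?_ ?_ fun v => ?_)).symm
    · exact (IsSelfAdjoint.one _).sub hPsa
    · exact IsIdempotentElem.one_sub hPidem
    · have hv := diag_entry_eq hS hPS v u
      simp [h1] at hv
      simp [hv, xi_apply]

end MatrixEntries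

section Components

variable {ω : ℕ → Fin n}

/-- Indices `u`, `v` are linked if they are joined by a chain of non-zero matrix entries of
`P`. -/
def Linked (P : Komega ω →L[ℂ] Komega ω) : Fomega ω → Fomega ω → Prop :=
  Relation.EqvGen fun u v => P (xi ω v) u ≠ 0

/-- The class of `u` under `Linked`. -/
def component (P : Komega ω →L[ℂ] Komega ω) (u : Fomega ω) : Set (FreeGroup (Fin n)) :=
  {g | ∃ v : Fomega ω, v.1 = g ∧ Linked P u v}

lemma coe_mem_component {P : Komega ω →L[ℂ] Komega ω} {u v : Fomega ω} :
    v.1 ∈ component P u ↔ Linked P u v :=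
  ⟨fun ⟨_, hw, h⟩ => Subtype.ext hw ▸ h, fun h => ⟨v, rfl, h⟩⟩

lemma component_eq_of_linked {P : Komega ω →L[ℂ] Komega ω} {u v : Fomega ω}
    (h : Linked P u v) : component P u = component P v := by
  ext g
  exact ⟨fun ⟨w, hw, huw⟩ => ⟨w, hw, (h.symm _ _).trans _ _ _ huw⟩,
    fun ⟨w, hw, hvw⟩ => ⟨w, hw, h.trans _ _ _ hvw⟩⟩

lemma GoodPartition.mem_iff_of_linked {Λ : Fomega ω → ℝ} {P : Komega ω →L[ℂ] Komega ω}
    {𝔓 : Set (Set (FreeGroup (Fin n)))} (h : GoodPartition ω Λ P 𝔓)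
    {J : Set (FreeGroup (Fin n))} (hJ : J ∈ 𝔓) {u v : Fomega ω} (huv : Linked P u v) :
    u.1 ∈ J ↔ v.1 ∈ J := by
  obtain ⟨Q, hQ⟩ := exists_isDiagProj (ω := ω) J
  have hedge := (commute_diagProj_iff hQ).1 (h.2.1 J hJ Q hQ)
  induction huv with
  | rel u v h => exact hedge u v h
  | refl u => rfl
  | symm u v _ ih => exact ih.symm
  | trans u v w _ _ ih₁ ih₂ => exact ih₁.trans ih₂

lemma GoodPartition.range_component {Λ : Fomega ω → ℝ} {P : Komega ω →L[ℂ] Komega ω}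
    {𝔓 : Set (Set (FreeGroup (Fin n)))} (h : GoodPartition ω Λ P 𝔓) :
    GoodPartition ω Λ P (Set.range (component P)) := by
  refine ⟨⟨?_, fun g hg => ?_⟩, ?_, ?_⟩
  · rintro _ ⟨u, rfl⟩
    exact ⟨⟨u, u, rfl, .refl u⟩, fun _ ⟨v, hv, _⟩ => hv ▸ v.2⟩
  · refine ⟨component P ⟨g, hg⟩, ⟨⟨_, rfl⟩, _, rfl, .refl _⟩, ?_⟩
    rintro _ ⟨⟨u, rfl⟩, v, rfl, huv⟩
    exact component_eq_of_linked huv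
  · rintro _ ⟨u, rfl⟩ Q hQ
    refine (commute_diagProj_iff hQ).2 fun v w hvw => ?_
    rw [coe_mem_component, coe_mem_component]
    exact ⟨fun huv => huv.trans _ _ _ (.rel _ _ hvw),
      fun huw => huw.trans _ _ _ (.symm _ _ (.rel _ _ hvw))⟩
  · rintro _ ⟨z, rfl⟩ u v hu hv
    obtain ⟨J, ⟨hJ, hzJ⟩, _⟩ := h.1.2 z z.2
    exact h.2.2 J hJ u v ((h.mem_iff_of_linked hJ (coe_mem_component.1 hu)).1 hzJ)
      ((h.mem_iff_of_linked hJ (coe_mem_component.1 hv)).1 hzJ)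

lemma GoodPartition.refinesPartition_range_component {Λ : Fomega ω → ℝ}
    {P : Komega ω →L[ℂ] Komega ω} {𝔓 : Set (Set (FreeGroup (Fin n)))}
    (h : GoodPartition ω Λ P 𝔓) : RefinesPartition (Set.range (component P)) 𝔓 := by
  intro J hJ
  refine ⟨component P '' {u | u.1 ∈ J}, Set.image_subset_range _ _, ?_⟩
  ext g
  constructor
  · intro hg
    let u : Fomega ω := ⟨g, (h.1.1 J hJ).2 hg⟩
    exact ⟨component P u, ⟨u, hg, rfl⟩, u, rfl, .refl u⟩
  · rintro ⟨_, ⟨u, hu, rfl⟩, v, rfl, huv⟩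
    exact (h.mem_iff_of_linked hJ huv).1 hu

variable {S : Fin n → Komega ω →L[ℂ] Komega ω} {P : Komega ω →L[ℂ] Komega ω}

lemma Linked.gen (hS : IsWeightedShiftR ω (fun _ => 1) S) (hPS : ∀ i : Fin n, Commute P (S i))
    {u v : Fomega ω} (h : Linked P u v) (i : Fin n) :
    Linked P (gen ω i u) (gen ω i v) := by
  induction h with
  | rel u v h => exact .rel _ _ (by rwa [entry_gen_gen hS hPS, if_pos rfl])
  | refl u => exact .refl _
  | symm u v _ ih => exact .symm _ _ ih
  | trans u v w _ _ ih₁ ih₂ => exact .trans _ _ _ ih₁ ih₂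

lemma Linked.exists_eq_gen (hS : IsWeightedShiftR ω (fun _ => 1) S)
    (hPS : ∀ i : Fin n, Commute P (S i)) {x y : Fomega ω} (h : Linked P x y) :
    ∃ i u v, x = _root_.gen ω i u ∧ y = _root_.gen ω i v ∧ Linked P u v := by
  induction h with
  | rel x y h =>
    obtain ⟨i, u, rfl⟩ := _root_.exists_eq_gen ω x
    obtain ⟨j, v, rfl⟩ := _root_.exists_eq_gen ω y
    rw [entry_gen_gen hS hPS] at h
    obtain ⟨rfl, h⟩ := ite_ne_right_iff.1 h
    exact ⟨_, u, v, rfl, rfl, .rel _ _ h⟩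
  | refl x =>
    obtain ⟨i, u, rfl⟩ := _root_.exists_eq_gen ω x
    exact ⟨i, u, u, rfl, rfl, .refl u⟩
  | symm x y _ ih =>
    obtain ⟨i, u, v, hx, hy, huv⟩ := ih
    exact ⟨i, v, u, hy, hx, huv.symm _ _⟩
  | trans x y z _ _ ih₁ ih₂ =>
    obtain ⟨i, u, v, hx, hy, huv⟩ := ih₁
    obtain ⟨j, v', w, hy', hz, hvw⟩ := ih₂
    obtain ⟨rfl, rfl⟩ := (gen_eq_gen_iff ω).1 (hy.symm.trans hy')
    exact ⟨i, u, w, hx, hz, huv.trans _ _ _ hvw⟩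

lemma mulSet_component (hS : IsWeightedShiftR ω (fun _ => 1) S)
    (hPS : ∀ i : Fin n, Commute P (S i)) (w : List (Fin n)) (u : Fomega ω) :
    mulSet w (component P u) = component P (wordAct ω w u) := by
  have hact : ∀ v, Linked P u v → Linked P (wordAct ω w u) (wordAct ω w v) := by
    intro v huv
    induction w with
    | nil => exact huv
    | cons i w ih => exact ih.gen hS hPS i
  have hlift : ∀ y, Linked P (wordAct ω w u) y → ∃ v, y = wordAct ω w v ∧ Linked P u v := by
    clear hact
    induction w with
    | nil => exact fun y hy => ⟨y, rfl, hy⟩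
    | cons i w ih =>
      intro y hy
      obtain ⟨j, x, z, hx, rfl, hxz⟩ := hy.exists_eq_gen hS hPS
      obtain ⟨rfl, rfl⟩ := (gen_eq_gen_iff ω).1 hx
      obtain ⟨v, rfl, huv⟩ := ih z hxz
      exact ⟨v, rfl, huv⟩
  ext g
  constructor
  · rintro ⟨_, ⟨v, rfl, huv⟩, rfl⟩
    exact ⟨wordAct ω w v, coe_wordAct ω w v, hact v huv⟩
  · rintro ⟨y, rfl, hy⟩
    obtain ⟨v, rfl, huv⟩ := hlift y hy
    exact ⟨v, ⟨v, rfl, huv⟩, (coe_wordAct ω w v).symm⟩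

lemma exists_linked_wordAct_of_entry_ne_zero (hS : IsWeightedShiftR ω (fun _ => 1) S)
    (hPS : ∀ i : Fin n, Commute P (S i)) (z : Fomega ω) {a b : List (Fin n)} (hab : a ≠ b)
    (h : P (xi ω (wordAct ω b z)) (wordAct ω a z) ≠ 0) :
    ∃ w : List (Fin n), w ≠ [] ∧ Linked P (wordAct ω w z) z := by
  induction a generalizing b with
  | nil => exact ⟨b, hab.symm, .symm _ _ (.rel _ _ h)⟩
  | cons i a ih =>
    cases b with
    | nil => exact ⟨i :: a, hab, .rel _ _ h⟩
    | cons j b =>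
      rw [wordAct_cons, wordAct_cons, entry_gen_gen hS hPS] at h
      obtain ⟨rfl, h⟩ := ite_ne_right_iff.1 h
      exact ih (fun hab' => hab (by rw [hab'])) h

end Components

/-- for a non-trivial orthogonal projection `P` commuting with the
unweighted shifts and a maximal partition `𝔓` with properties (a) and (b), every member
of `𝔓` has at least two elements, and some member `J₁` satisfies `wJ₁ = J₁` for a
non-empty word `w`; in particular `J₁` meets the main branch `{ω_m⁻¹ : m ≥ 0}`. -/
theorem maximal_partition_member_fixed_by_word
    {n : ℕ} (hn : 2 ≤ n) (ω : ℕ → Fin n)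
    (Λ : Fomega ω → ℝ) (hbdd : ∃ C : ℝ, ∀ u, ‖Λ u‖ ≤ C) (hpos : ∀ u, 0 < Λ u)
    (S : Fin n → Komega ω →L[ℂ] Komega ω) (hS : IsWeightedShiftR ω (fun _ => 1) S)
    (P : Komega ω →L[ℂ] Komega ω) (hPsa : IsSelfAdjoint P) (hPidem : P * P = P)
    (hP0 : P ≠ 0) (hP1 : P ≠ 1)
    (hPS : ∀ i : Fin n, Commute P (S i))
    (𝔓 : Set (Set (FreeGroup (Fin n)))) (hgood : GoodPartition ω Λ P 𝔓)
    (hmax : ∀ 𝔓' : Set (Set (FreeGroup (Fin n))),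
      GoodPartition ω Λ P 𝔓' → RefinesPartition 𝔓' 𝔓 → 𝔓' = 𝔓) :
    (∀ J ∈ 𝔓, ∃ a ∈ J, ∃ b ∈ J, a ≠ b) ∧
    ∃ J₁ ∈ 𝔓, ∃ w : List (Fin n), w ≠ [] ∧ mulSet w J₁ = J₁ ∧
      ∃ m : ℕ, (wordProd (initSeg ω m))⁻¹ ∈ J₁ := by
  obtain rfl : Set.range (component P) = 𝔓 :=
    hmax _ hgood.range_component hgood.refinesPartition_range_component
  have hoff := exists_offDiag_entry_ne_zero hS hPsa hPidem hP0 hP1 hPS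
  constructor
  · rintro _ ⟨u, rfl⟩
    obtain ⟨v, hvu, hv⟩ := hoff u
    exact ⟨u, coe_mem_component.2 (.refl u), v,
      coe_mem_component.2 (.symm _ _ (.rel _ _ hv)), fun h => hvu (Subtype.ext h.symm)⟩
  · obtain ⟨v, hvu, hv⟩ := hoff (branch ω 0)
    obtain ⟨m, a, b, ha, hb⟩ := exists_common_branch ω v (branch ω 0)
    rw [ha, hb] at hv hvu
    obtain ⟨w, hw, hlink⟩ := exists_linked_wordAct_of_entry_ne_zero hS hPS (branch ω m)
      (fun hab => hvu (by rw [hab])) hv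
    exact ⟨component P (branch ω m), ⟨_, rfl⟩, w, hw,
      (mulSet_component hS hPS w _).trans (component_eq_of_linked hlink),
      m, coe_mem_component.2 (.refl (branch ω m))⟩
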